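/- The identity σ_λ(z)·σ_μ(z) = σ_{λ+μ}(z)·(ζ(z) − ζ(λ) − ζ(μ) − ζ(z−λ−μ)) holds, where ζ is the Weierstrass zeta function with periods 1 and τ. -/

import Mathlib

open Complex

/-- Jacobi theta function `θ₁(z,τ) = Σ_{n∈ℤ+1/2} exp(iπn²τ + 2πin(z+1/2))`. -/
noncomputable def theta1 (z τ : ℂ) : ℂ :=
  ∑' n : ℤ, Complex.exp (Real.pi * I * ((n : ℂ) + 1/2)^2 * τ +
    2 * Real.pi * I * ((n : ℂ) + 1/2) * (z + 1/2))

/-- `θ₁′(0,τ)`, the derivative of `θ₁` in the first variable at `0`. -/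
noncomputable def theta1'0 (τ : ℂ) : ℂ := deriv (fun w => theta1 w τ) 0

/-- The function `σ_μ(z) = θ₁(z−μ,τ)θ₁′(0,τ)/(θ₁(z,τ)θ₁(−μ,τ))`. -/
noncomputable def sigmaE (τ μ z : ℂ) : ℂ :=
  theta1 (z - μ) τ * theta1'0 τ / (theta1 z τ * theta1 (-μ) τ)

/-- The lattice `ℤ + τℤ`. -/
def lattice (τ : ℂ) : Set ℂ := {w | ∃ m n : ℤ, w = (m : ℂ) + (n : ℂ) * τ}

/-- Weierstrass zeta function for the lattice ℤ + τℤ. -/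
noncomputable def wzeta (τ z : ℂ) : ℂ :=
  1 / z + ∑' p : {q : ℤ × ℤ // q ≠ 0},
    (1 / (z - ((p.1.1 : ℂ) + (p.1.2 : ℂ) * τ))
      + 1 / ((p.1.1 : ℂ) + (p.1.2 : ℂ) * τ)
      + z / ((p.1.1 : ℂ) + (p.1.2 : ℂ) * τ) ^ 2)

open Filter Topology

section EllipticFunctions

variable {τ : ℂ}

lemma lattice_neg_mem {a : ℂ} (ha : a ∈ lattice τ) : -a ∈ lattice τ := by
  obtain ⟨m, n, rfl⟩ := ha
  exact ⟨-m, -n, by push_cast; ring⟩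

lemma lattice_neg_mem_iff {a : ℂ} : -a ∈ lattice τ ↔ a ∈ lattice τ :=
  ⟨fun h ↦ by simpa using lattice_neg_mem h, lattice_neg_mem⟩

lemma zero_mem_lattice : (0 : ℂ) ∈ lattice τ := ⟨0, 0, by simp⟩

/-- A function with periods `1` and `τ` is invariant under translation by the lattice. -/
lemma add_lattice_eq {h : ℂ → ℂ} (h1 : ∀ z, h (z + 1) = h z) (h2 : ∀ z, h (z + τ) = h z)
    {l : ℂ} (hl : l ∈ lattice τ) (z : ℂ) : h (z + l) = h z := by
  obtain ⟨m, n, rfl⟩ := hl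
  have e1 := (show Function.Periodic h 1 from h1).int_mul m
  have e2 := (show Function.Periodic h τ from h2).int_mul n
  rw [← add_assoc, e2, ← mul_one (m : ℂ), e1]

/-- An entire function with periods `1` and `τ` is constant. -/
lemma exists_eq_const_of_entire_of_periodic (hτ : 0 < τ.im) {G : ℂ → ℂ}
    (hG : Differentiable ℂ G) (h1 : ∀ z, G (z + 1) = G z) (h2 : ∀ z, G (z + τ) = G z) :
    ∃ c, ∀ z, G z = c := by
  refine hG.exists_const_forall_eq_of_bounded ?_
  have hK : IsCompact ((fun p : ℝ × ℝ ↦ G (p.1 + p.2 * τ)) '' Set.Icc 0 1 ×ˢ Set.Icc 0 1) := by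
    refine (isCompact_Icc.prod isCompact_Icc).image ?_
    exact hG.continuous.comp (by fun_prop)
  refine hK.isBounded.subset ?_
  rintro _ ⟨z, rfl⟩
  set b : ℝ := z.im / τ.im
  set a : ℝ := z.re - b * τ.re
  have hz : z = a + b * τ := by
    apply Complex.ext
    · simp [a]
    · simp [b]; field_simp
  refine ⟨(Int.fract a, Int.fract b),
    ⟨⟨Int.fract_nonneg _, (Int.fract_lt_one _).le⟩, ⟨Int.fract_nonneg _, (Int.fract_lt_one _).le⟩⟩, ?_⟩
  have hl : ((⌊a⌋ : ℂ) + (⌊b⌋ : ℂ) * τ) ∈ lattice τ := ⟨_, _, rfl⟩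
  change G (_ + _) = G z
  rw [← add_lattice_eq h1 h2 hl]
  congr 1
  rw [hz, Int.fract, Int.fract]
  push_cast
  ring

lemma tendsto_add_nhdsNE (a z : ℂ) : Tendsto (fun w ↦ w + a) (𝓝[≠] z) (𝓝[≠] (z + a)) :=
  tendsto_nhdsWithin_of_tendsto_nhds_of_eventually_within _
    (tendsto_nhdsWithin_of_tendsto_nhds (by apply Continuous.tendsto; fun_prop))
    (eventually_mem_nhdsWithin.mono fun w hw ↦ by simpa using hw)

/-- A function with periods `1` and `τ` that agrees, near a translate of every point, with an
analytic function is constant wherever it is continuous. -/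
lemma exists_eq_const_of_periodic (hτ : 0 < τ.im) {h : ℂ → ℂ}
    (h1 : ∀ z, h (z + 1) = h z) (h2 : ∀ z, h (z + τ) = h z)
    (hloc : ∀ z, ∃ l ∈ lattice τ, ∃ g : ℂ → ℂ, AnalyticAt ℂ g (z + l) ∧ h =ᶠ[𝓝[≠] (z + l)] g) :
    ∃ c, ∀ z, ContinuousAt h z → h z = c := by
  have hloc' : ∀ z, ∃ g : ℂ → ℂ, AnalyticAt ℂ g z ∧ h =ᶠ[𝓝[≠] z] g := by
    intro z
    obtain ⟨l, hl, g, hg, hgh⟩ := hloc z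
    refine ⟨fun w ↦ g (w + l), hg.fun_comp (f := fun w ↦ w + l) (by fun_prop), ?_⟩
    filter_upwards [(tendsto_add_nhdsNE l z).eventually hgh] with w hw
    rw [← hw, add_lattice_eq h1 h2 hl]
  choose g hg hgh using hloc'
  have hlim : ∀ z, Tendsto h (𝓝[≠] z) (𝓝 (g z z)) := fun z ↦
    ((hg z).continuousAt.tendsto.mono_left nhdsWithin_le_nhds).congr' (hgh z).symm
  have hper : ∀ p, (∀ z, h (z + p) = h z) → ∀ z, g (z + p) (z + p) = g z z := by
    intro p hp z
    refine tendsto_nhds_unique (((hlim (z + p)).comp (tendsto_add_nhdsNE p z)).congr fun w ↦ ?_) (hlim z)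
    exact hp w
  have hent : Differentiable ℂ fun z ↦ g z z := by
    intro z
    refine (hg z).differentiableAt.congr_of_eventuallyEq ?_
    have e1 : ∀ᶠ w in 𝓝[≠] z, AnalyticAt ℂ (g z) w :=
      nhdsWithin_le_nhds (hg z).eventually_analyticAt
    have e2 : ∀ᶠ w in 𝓝[≠] z, h =ᶠ[𝓝 w] g z := by
      have := eventually_eventually_nhdsWithin.mpr (hgh z)
      filter_upwards [this, self_mem_nhdsWithin] with w hw hwz
      rwa [isOpen_compl_singleton.nhdsWithin_eq hwz] at hw
    have e3 : ∀ᶠ w in 𝓝[≠] z, g w w = g z w := by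
      filter_upwards [e1, e2] with w hw1 hw2
      refine tendsto_nhds_unique (hlim w) ?_
      exact (hw1.continuousAt.tendsto.mono_left nhdsWithin_le_nhds).congr'
        (hw2.symm.filter_mono nhdsWithin_le_nhds)
    exact eventually_nhdsWithin_iff.mp e3 |>.mono fun w hw ↦ by
      by_cases hwz : w = z
      · rw [hwz]
      · exact hw hwz
  obtain ⟨c, hc⟩ := exists_eq_const_of_entire_of_periodic hτ hent (hper 1 h1) (hper τ h2)
  refine ⟨c, fun z hz ↦ ?_⟩
  rw [← hc z]
  exact tendsto_nhds_unique (hz.tendsto.mono_left nhdsWithin_le_nhds) (hlim z)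

/-- An analytic function vanishing at `0` is divisible by `z`. -/
lemma exists_analyticAt_eq_mul {f : ℂ → ℂ} (hf : AnalyticAt ℂ f 0) (h0 : f 0 = 0) :
    ∃ g : ℂ → ℂ, AnalyticAt ℂ g 0 ∧ g 0 = deriv f 0 ∧ ∀ z, f z = z * g z := by
  obtain ⟨p, hp⟩ := hf
  refine ⟨dslope f 0, ⟨_, hp.has_fpower_series_dslope_fslope⟩, dslope_same f 0, fun z ↦ ?_⟩
  simpa [h0] using (sub_smul_dslope f 0 z).symm

lemma theta1_eq_jacobiTheta₂ (z τ : ℂ) :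
    theta1 z τ = cexp (Real.pi * I * (τ / 4 - z - 1 / 2)) *
      jacobiTheta₂ (z + 1 / 2 - τ / 2) τ := by
  rw [theta1, jacobiTheta₂, ← tsum_mul_left, ← (Equiv.subRight (1 : ℤ)).tsum_eq]
  refine tsum_congr fun n ↦ ?_
  rw [jacobiTheta₂_term, ← Complex.exp_add, Equiv.subRight_apply]
  congr 1
  push_cast
  ring

lemma differentiable_theta1 (hτ : 0 < τ.im) : Differentiable ℂ fun z ↦ theta1 z τ := by
  intro z
  simp_rw [theta1_eq_jacobiTheta₂]
  refine DifferentiableAt.mul (by fun_prop) ?_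
  exact (differentiableAt_jacobiTheta₂_fst (z + 1 / 2 - τ / 2) hτ).comp z
    (f := fun z ↦ z + 1 / 2 - τ / 2) (by fun_prop)

lemma exp_pi_mul_I_mul_sub_one (a : ℂ) :
    cexp (Real.pi * I * (a - 1)) = -cexp (Real.pi * I * a) := by
  rw [mul_sub, Complex.exp_sub, mul_one, Complex.exp_pi_mul_I, div_neg, div_one]

lemma theta1_add_one (z τ : ℂ) : theta1 (z + 1) τ = -theta1 z τ := by
  rw [theta1_eq_jacobiTheta₂, theta1_eq_jacobiTheta₂ z,
    show z + 1 + 1 / 2 - τ / 2 = z + 1 / 2 - τ / 2 + 1 by ring, jacobiTheta₂_add_left,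
    show τ / 4 - (z + 1) - 1 / 2 = τ / 4 - z - 1 / 2 - 1 by ring, exp_pi_mul_I_mul_sub_one,
    neg_mul]

lemma theta1_add_tau (z τ : ℂ) :
    theta1 (z + τ) τ = -(cexp (-(Real.pi * I * (τ + 2 * z))) * theta1 z τ) := by
  rw [theta1_eq_jacobiTheta₂, theta1_eq_jacobiTheta₂ z,
    show z + τ + 1 / 2 - τ / 2 = z + 1 / 2 - τ / 2 + τ by ring, jacobiTheta₂_add_left',
    ← mul_assoc, ← mul_assoc, ← Complex.exp_add, ← Complex.exp_add, ← neg_mul,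
    show Real.pi * I * (τ / 4 - (z + τ) - 1 / 2) +
      -Real.pi * I * (τ + 2 * (z + 1 / 2 - τ / 2)) =
      Real.pi * I * (-(τ + 2 * z) + (τ / 4 - z - 1 / 2) - 1) by ring,
    exp_pi_mul_I_mul_sub_one]
  congr 3
  ring

lemma theta1_neg (z τ : ℂ) : theta1 (-z) τ = -theta1 z τ := by
  rw [theta1_eq_jacobiTheta₂, theta1_eq_jacobiTheta₂ z, ← jacobiTheta₂_neg_left,
    ← jacobiTheta₂_add_left,
    show -(-z + 1 / 2 - τ / 2) + 1 = z + 1 / 2 - τ / 2 + τ by ring, jacobiTheta₂_add_left',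
    ← mul_assoc, ← Complex.exp_add, ← neg_mul, ← exp_pi_mul_I_mul_sub_one]
  congr 2
  ring

lemma theta1_zero (τ : ℂ) : theta1 0 τ = 0 := by
  have := theta1_neg 0 τ
  rw [neg_zero] at this
  exact CharZero.eq_neg_self_iff.mp this

/-- The infinite product `∏_{n ≥ 0} (1 - qⁿ w)`. -/
noncomputable def qProd (q w : ℂ) : ℂ := ∏' n : ℕ, (1 + -(q ^ n * w))

lemma summable_norm_qProd {q : ℂ} (hq : ‖q‖ < 1) (w : ℂ) :
    Summable fun n : ℕ ↦ ‖-(q ^ n * w)‖ := by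
  simpa using (summable_geometric_of_lt_one (norm_nonneg q) hq).mul_right ‖w‖

lemma qProd_eq_mul {q : ℂ} (hq : ‖q‖ < 1) (w : ℂ) :
    qProd q w = (1 - w) * qProd q (q * w) := by
  have e : (fun n : ℕ ↦ 1 + -(q ^ (n + 1) * w)) = fun n ↦ 1 + -(q ^ n * (q * w)) := by
    funext n
    ring
  have hm : Multipliable fun n : ℕ ↦ 1 + -(q ^ (n + 1) * w) := by
    rw [e]
    exact multipliable_one_add_of_summable (summable_norm_qProd hq (q * w))
  have h := tprod_eq_zero_mul' (f := fun n : ℕ ↦ 1 + -(q ^ n * w)) hm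
  rw [e, pow_zero, one_mul, ← sub_eq_add_neg] at h
  exact h

lemma qProd_ne_zero {q w : ℂ} (hq : ‖q‖ < 1) (hw : ∀ n : ℕ, q ^ n * w ≠ 1) : qProd q w ≠ 0 := by
  refine tprod_one_add_ne_zero_of_summable (fun n h ↦ hw n ?_) (summable_norm_qProd hq w)
  linear_combination -h

lemma differentiable_qProd {q : ℂ} (hq : ‖q‖ < 1) : Differentiable ℂ (qProd q) := by
  intro w
  have hB : IsOpen (Metric.ball (0 : ℂ) (‖w‖ + 1)) := Metric.isOpen_ball
  have H := ((summable_geometric_of_lt_one (norm_nonneg q) hq).mul_right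
    (‖w‖ + 1)).hasProdLocallyUniformlyOn_nat_one_add (f := fun n w ↦ -(q ^ n * w)) hB
    (.of_forall fun n x hx ↦ by
      rw [norm_neg, norm_mul, norm_pow]
      gcongr
      simpa using (Metric.mem_ball.mp hx).le) (fun n ↦ by fun_prop)
  refine (H.differentiableOn (.of_forall fun s ↦ ?_) hB).differentiableAt (hB.mem_nhds (by simp))
  simpa [Finset.prod_fn] using DifferentiableOn.finsetProd (fun _ _ ↦ by fun_prop)

/-- The product `∏_{n ≥ 0} (1 - qⁿ w) (1 - qⁿ⁺¹ w⁻¹)` with `q = exp (2πiτ)`, `w = exp (2πiz)`; it is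
proportional to `θ₁` up to an exponential factor. -/
noncomputable def thetaProd (τ z : ℂ) : ℂ :=
  qProd (cexp (2 * Real.pi * I * τ)) (cexp (2 * Real.pi * I * z)) *
    qProd (cexp (2 * Real.pi * I * τ)) (cexp (2 * Real.pi * I * (τ - z)))

lemma norm_exp_two_pi_I_mul_lt_one (hτ : 0 < τ.im) : ‖cexp (2 * Real.pi * I * τ)‖ < 1 := by
  rw [Complex.norm_exp]
  simp
  positivity

lemma exp_two_pi_I_mul_eq_one_iff (z : ℂ) :
    cexp (2 * Real.pi * I * z) = 1 ↔ ∃ n : ℤ, z = n := by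
  have h := Complex.two_pi_I_ne_zero
  rw [Complex.exp_eq_one_iff]
  refine exists_congr fun n ↦ ?_
  rw [mul_comm (n : ℂ), mul_right_inj' h]

lemma exp_two_pi_I_mul_add_one (z : ℂ) :
    cexp (2 * Real.pi * I * (z + 1)) = cexp (2 * Real.pi * I * z) := by
  rw [mul_add, mul_one, Complex.exp_periodic]

lemma thetaProd_add_one (τ z : ℂ) : thetaProd τ (z + 1) = thetaProd τ z := by
  rw [thetaProd, thetaProd, exp_two_pi_I_mul_add_one, ← exp_two_pi_I_mul_add_one (τ - (z + 1))]
  congr 4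
  ring

lemma thetaProd_add_tau (hτ : 0 < τ.im) (z : ℂ) :
    thetaProd τ (z + τ) = -cexp (-(2 * Real.pi * I * z)) * thetaProd τ z := by
  have hq := norm_exp_two_pi_I_mul_lt_one hτ
  rw [thetaProd, thetaProd, qProd_eq_mul hq (cexp (2 * Real.pi * I * z)),
    qProd_eq_mul hq (cexp (2 * Real.pi * I * (τ - (z + τ))))]
  simp_rw [← Complex.exp_add, ← mul_add]
  have e1 : τ + (τ - (z + τ)) = τ - z := by ring
  have e2 : 2 * Real.pi * I * (τ - (z + τ)) = -(2 * Real.pi * I * z) := by ring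
  rw [e1, e2, add_comm z τ]
  have e3 : cexp (-(2 * Real.pi * I * z)) * cexp (2 * Real.pi * I * z) = 1 := by
    rw [← Complex.exp_add]; simp
  linear_combination -(qProd (cexp (2 * Real.pi * I * τ)) (cexp (2 * Real.pi * I * (τ + z))) *
    qProd (cexp (2 * Real.pi * I * τ)) (cexp (2 * Real.pi * I * (τ - z)))) * e3

lemma exp_pow_mul_exp (τ z : ℂ) (n : ℕ) :
    cexp (2 * Real.pi * I * τ) ^ n * cexp (2 * Real.pi * I * z) =
      cexp (2 * Real.pi * I * (n * τ + z)) := by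
  rw [← Complex.exp_nat_mul, ← Complex.exp_add]
  congr 1
  ring

lemma thetaProd_ne_zero (hτ : 0 < τ.im) {z : ℂ} (hz : z ∉ lattice τ) : thetaProd τ z ≠ 0 := by
  have hq := norm_exp_two_pi_I_mul_lt_one hτ
  refine mul_ne_zero (qProd_ne_zero hq fun n h ↦ hz ?_) (qProd_ne_zero hq fun n h ↦ hz ?_) <;>
  · rw [exp_pow_mul_exp, exp_two_pi_I_mul_eq_one_iff] at h
    obtain ⟨m, hm⟩ := h
    first
      | exact ⟨m, -n, by push_cast; linear_combination hm⟩
      | exact ⟨-m, n + 1, by push_cast; linear_combination -hm⟩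

lemma differentiable_thetaProd (hτ : 0 < τ.im) : Differentiable ℂ (thetaProd τ) := by
  have h := differentiable_qProd (norm_exp_two_pi_I_mul_lt_one hτ)
  exact .mul (h.comp (by fun_prop)) (h.comp (by fun_prop))

/-- The product `thetaProd` has a simple zero at `0`. -/
lemma exists_thetaProd_eq_mul (hτ : 0 < τ.im) :
    ∃ R : ℂ → ℂ, AnalyticAt ℂ R 0 ∧ R 0 ≠ 0 ∧ ∀ z, thetaProd τ z = z * R z := by
  have hq := norm_exp_two_pi_I_mul_lt_one hτ
  have hd := differentiable_qProd hq
  have hq0 : ∀ n : ℕ, cexp (2 * Real.pi * I * τ) ^ n * cexp (2 * Real.pi * I * τ) ≠ 1 := by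
    intro n h
    rw [exp_pow_mul_exp, exp_two_pi_I_mul_eq_one_iff] at h
    obtain ⟨m, hm⟩ := h
    have := congrArg Complex.im hm
    simp at this
    nlinarith [(Nat.cast_nonneg n : (0 : ℝ) ≤ n), mul_nonneg (Nat.cast_nonneg n : (0 : ℝ) ≤ n) hτ.le]
  have hu : Differentiable ℂ fun z ↦ 1 - cexp (2 * Real.pi * I * z) := by fun_prop
  obtain ⟨u, hua, hu0, hu⟩ := exists_analyticAt_eq_mul (hu.analyticAt 0) (by simp)
  have hu0' : u 0 ≠ 0 := by
    have : HasDerivAt (fun z : ℂ ↦ 1 - cexp (2 * Real.pi * I * z))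
        (-(cexp (2 * Real.pi * I * 0) * (2 * Real.pi * I * 1))) 0 :=
      (((hasDerivAt_id (0 : ℂ)).const_mul _).cexp).const_sub 1
    rw [hu0, this.deriv]
    simp
  set q := cexp (2 * Real.pi * I * τ)
  have hv : Differentiable ℂ fun z ↦ qProd q (q * cexp (2 * Real.pi * I * z)) *
      qProd q (cexp (2 * Real.pi * I * (τ - z))) := .mul (hd.comp (by fun_prop)) (hd.comp (by fun_prop))
  refine ⟨fun z ↦ u z * (qProd q (q * cexp (2 * Real.pi * I * z)) *
    qProd q (cexp (2 * Real.pi * I * (τ - z)))), hua.mul (hv.analyticAt 0), ?_, fun z ↦ ?_⟩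
  · have := qProd_ne_zero hq hq0
    simp [hu0', q] at this ⊢
    exact this
  · rw [thetaProd, qProd_eq_mul hq, hu z]
    ring

/-- If `θ₁′(0) ≠ 0`, then `θ₁` does not vanish outside the lattice. -/
lemma theta1_ne_zero (hτ : 0 < τ.im) (h0 : theta1'0 τ ≠ 0) {z : ℂ} (hz : z ∉ lattice τ) :
    theta1 z τ ≠ 0 := by
  intro hθz
  have hθ := differentiable_theta1 hτ
  have hP := differentiable_thetaProd hτ
  obtain ⟨R, hR, hR0, hPR⟩ := exists_thetaProd_eq_mul hτ
  obtain ⟨t, ht, -, hθt⟩ := exists_analyticAt_eq_mul (hθ.analyticAt 0) (theta1_zero τ)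
  set h : ℂ → ℂ := fun z ↦ cexp (Real.pi * I * z) * theta1 z τ / thetaProd τ z with hh
  have hana : ∀ w, thetaProd τ w ≠ 0 → AnalyticAt ℂ h w := fun w hw ↦
    .div (.mul (Differentiable.analyticAt (by fun_prop) w) (hθ.analyticAt w)) (hP.analyticAt w) hw
  have h1 : ∀ z, h (z + 1) = h z := by
    intro z
    simp only [hh, thetaProd_add_one, theta1_add_one, mul_add, mul_one, Complex.exp_add,
      Complex.exp_pi_mul_I]
    ring
  have h2 : ∀ z, h (z + τ) = h z := by
    intro z
    have hne : -cexp (-(2 * Real.pi * I * z)) ≠ 0 := neg_ne_zero.mpr (Complex.exp_ne_zero _)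
    simp only [hh, thetaProd_add_tau hτ, theta1_add_tau]
    rw [← mul_div_mul_left _ (thetaProd τ z) hne]
    congr 1
    rw [mul_neg, ← mul_assoc, ← mul_assoc, neg_mul, neg_mul, ← Complex.exp_add, ← Complex.exp_add]
    congr 3
    ring
  obtain ⟨c, hc⟩ := exists_eq_const_of_periodic hτ h1 h2 (by
    intro z
    by_cases hz : z ∈ lattice τ
    · refine ⟨-z, lattice_neg_mem hz, fun z ↦ cexp (Real.pi * I * z) * t z / R z, ?_, ?_⟩
      · rw [add_neg_cancel]
        exact .div (.mul (Differentiable.analyticAt (by fun_prop) 0) ht) hR hR0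
      · rw [add_neg_cancel]
        filter_upwards [self_mem_nhdsWithin] with w hw
        simp only [hh, hPR, hθt]
        rw [mul_left_comm, mul_div_mul_left _ _ hw]
    · exact ⟨0, zero_mem_lattice, h, hana _ (by simpa using thetaProd_ne_zero hτ hz), .rfl⟩)
  have hc0 : c = 0 := by
    rw [← hc z (hana z (thetaProd_ne_zero hτ hz)).continuousAt]
    simp [hh, hθz]
  refine h0 ?_
  have hev : (fun w ↦ theta1 w τ) =ᶠ[𝓝 0] fun _ ↦ 0 := by
    filter_upwards [hR.continuousAt.eventually_ne hR0] with w hw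
    by_cases hw0 : w = 0
    · rw [hw0, theta1_zero]
    · have hPw : thetaProd τ w ≠ 0 := by
        rw [hPR]
        exact mul_ne_zero hw0 hw
      have := hc w (hana w hPw).continuousAt
      simpa [hh, hc0, hPw] using this
  rw [theta1'0, hev.deriv_eq, deriv_const]

/-- The pair of periods `1`, `τ`. -/
noncomputable def periodPairOneTau (hτ : 0 < τ.im) : PeriodPair where
  ω₁ := 1
  ω₂ := τ
  indep := by
    rw [LinearIndependent.pair_iff]
    intro s t h
    have ht : t = 0 := by
      have := congrArg Complex.im h
      simpa [hτ.ne'] using this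
    subst ht
    simpa using h

lemma mem_periodPairOneTau_lattice (hτ : 0 < τ.im) {z : ℂ} :
    z ∈ (periodPairOneTau hτ).lattice ↔ z ∈ lattice τ := by
  simp only [PeriodPair.mem_lattice, lattice, Set.mem_ofPred_eq, periodPairOneTau, mul_one, eq_comm]

/-- The summand of the Weierstrass zeta function. -/
noncomputable def zetaTerm (l z : ℂ) : ℂ := 1 / (z - l) + 1 / l + z / l ^ 2

lemma norm_zetaTerm_le {r : ℝ} {s l : ℂ} (hr : 0 < r) (hs : ‖s‖ < r) (h : 2 * r ≤ ‖l‖) :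
    ‖zetaTerm l s‖ ≤ 2 * r ^ 2 * ‖l‖ ^ (-3 : ℝ) := by
  have hl : 0 < ‖l‖ := by linarith
  have hl0 : l ≠ 0 := norm_pos_iff.mp hl
  have hsl : ‖l‖ / 2 ≤ ‖s - l‖ := by
    rw [norm_sub_rev]
    exact .trans (by linarith) (norm_sub_norm_le l s)
  have hsl0 : s - l ≠ 0 := norm_pos_iff.mp (by linarith)
  have e : zetaTerm l s = s ^ 2 / (l ^ 2 * (s - l)) := by
    rw [zetaTerm]
    field_simp
    ring
  calc ‖zetaTerm l s‖ = ‖s‖ ^ 2 / (‖l‖ ^ 2 * ‖s - l‖) := by rw [e]; simp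
    _ ≤ r ^ 2 / (‖l‖ ^ 2 * (‖l‖ / 2)) := by gcongr
    _ = 2 * r ^ 2 / ‖l‖ ^ 3 := by field
    _ = _ := by norm_cast

/-- The Weierstrass zeta function with its pole at `0` removed. -/
noncomputable def zetaRegular (hτ : 0 < τ.im) (z : ℂ) : ℂ :=
  ∑' l : (periodPairOneTau hτ).lattice, if l.1 = 0 then 0 else zetaTerm l z

lemma hasSumLocallyUniformly_zetaRegular (hτ : 0 < τ.im) :
    HasSumLocallyUniformly
      (fun (l : (periodPairOneTau hτ).lattice) (z : ℂ) ↦ if l.1 = 0 then 0 else zetaTerm l z)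
      (zetaRegular hτ) := by
  refine (periodPairOneTau hτ).hasSumLocallyUniformly_aux
    (u := fun r l ↦ 2 * r ^ 2 * ‖l‖ ^ (-3 : ℝ)) _
    (fun _ _ ↦ (ZLattice.summable_norm_rpow _ _ (by simp; norm_num)).mul_left _) fun r hr ↦
    Filter.eventually_atTop.mpr ⟨2 * r, ?_⟩
  rintro _ h s hs l rfl
  split_ifs
  · simp only [norm_zero]
    positivity
  · exact norm_zetaTerm_le hr hs h

lemma analyticAt_zetaRegular (hτ : 0 < τ.im) {z : ℂ} (hz : z = 0 ∨ z ∉ lattice τ) :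
    AnalyticAt ℂ (zetaRegular hτ) z := by
  have hopen := (periodPairOneTau hτ).isOpen_compl_lattice_sdiff (s := {0})
  refine DifferentiableOn.analyticAt (s := ((periodPairOneTau hτ).lattice \ {0} : Set ℂ)ᶜ) ?_
    (hopen.mem_nhds ?_)
  · refine (hasSumLocallyUniformly_zetaRegular hτ).hasSumLocallyUniformlyOn.differentiableOn
      (.of_forall fun s ↦ .fun_sum fun i hi ↦ ?_) hopen
    split_ifs with h
    · simp
    · simp only [zetaTerm]
      refine .add (.add (.div (by fun_prop) (by fun_prop) fun x hx hxi ↦ hx ?_) (by fun_prop))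
        (by fun_prop)
      rw [sub_eq_zero.mp hxi]
      exact ⟨i.2, h⟩
  · rintro ⟨h1, h2⟩
    rcases hz with hz | hz
    · exact h2 hz
    · exact hz ((mem_periodPairOneTau_lattice hτ).mp h1)

lemma wzeta_eq_add_zetaRegular (hτ : 0 < τ.im) (z : ℂ) :
    wzeta τ z = 1 / z + zetaRegular hτ z := by
  rw [wzeta, zetaRegular, ← (periodPairOneTau hτ).latticeEquivProd.symm.toEquiv.tsum_eq]
  congr 1
  refine (tsum_subtype {q : ℤ × ℤ | q ≠ 0} fun p ↦ 1 / (z - ((p.1 : ℂ) + (p.2 : ℂ) * τ))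
      + 1 / ((p.1 : ℂ) + (p.2 : ℂ) * τ) + z / ((p.1 : ℂ) + (p.2 : ℂ) * τ) ^ 2).trans
    (tsum_congr fun p ↦ ?_)
  have e : ((periodPairOneTau hτ).latticeEquivProd.symm p).1 = p.1 + p.2 * τ := by
    rw [PeriodPair.latticeEquiv_symm_apply]
    simp [periodPairOneTau]
  simp only [LinearEquiv.coe_toEquiv]
  by_cases hp : p = 0
  · simp [hp]
  · have hp' : ((periodPairOneTau hτ).latticeEquivProd.symm p).1 ≠ 0 := by simpa using hp
    rw [Set.indicator_of_mem hp, if_neg hp', zetaTerm, e]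

lemma hasSum_wzeta (hτ : 0 < τ.im) (z : ℂ) :
    HasSum (fun l : (periodPairOneTau hτ).lattice ↦ zetaTerm l z) (wzeta τ z) := by
  rw [wzeta_eq_add_zetaRegular hτ, add_comm]
  convert (hasSumLocallyUniformly_zetaRegular hτ).hasSum (x := z) |>.add
    (hasSum_ite_eq (0 : (periodPairOneTau hτ).lattice) (1 / z)) using 2 with l
  by_cases hl : l = 0 <;> simp [hl, zetaTerm]

lemma wzeta_neg (hτ : 0 < τ.im) (z : ℂ) : wzeta τ (-z) = -wzeta τ z := by
  refine (hasSum_wzeta hτ (-z)).unique ?_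
  rw [← (Equiv.neg (periodPairOneTau hτ).lattice).hasSum_iff]
  convert! (hasSum_wzeta hτ z).neg using 2 with l
  simp only [zetaTerm, Function.comp, Equiv.neg_apply, Submodule.coe_neg]
  rw [← neg_sub', div_neg, div_neg, neg_sq, neg_div]
  ring

/-- Quasi-periodicity of the Weierstrass zeta function, with its increment written as
`ζ(l) - ζ(0)`, where `ζ(0)` and `ζ(l)` are the values of the series without its polar term. -/
lemma wzeta_add (hτ : 0 < τ.im) {l : ℂ} (hl : l ∈ lattice τ) (z : ℂ) :
    wzeta τ (z + l) = wzeta τ z + (wzeta τ l - wzeta τ 0) := by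
  set L := periodPairOneTau hτ
  set l₀ : L.lattice := ⟨l, (mem_periodPairOneTau_lattice hτ).mpr hl⟩ with hl₀
  have key : ∀ w, HasSum (fun i : L.lattice ↦ 1 / i.1 - 1 / (i.1 - l) + l / i.1 ^ 2)
      (wzeta τ (w + l) - wzeta τ w) := by
    intro w
    have h1 := hasSum_wzeta hτ (w + l)
    have h2 := hasSum_wzeta hτ w
    rw [← (Equiv.subRight l₀).hasSum_iff] at h2
    have h3 := (L.hasSum_weierstrassP l).mul_left w
    rw [show L.weierstrassP l = 0 from L.weierstrassP_coe l₀, mul_zero] at h3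
    rw [← add_zero (wzeta τ (w + l) - wzeta τ w)]
    convert! (h1.sub h2).add h3 using 2 with i
    simp only [zetaTerm, Function.comp, Equiv.subRight_apply, AddSubgroupClass.coe_sub, hl₀]
    rw [show w - (i.1 - l) = w + l - i.1 by ring, show (l - i.1) ^ 2 = (i.1 - l) ^ 2 by ring]
    ring
  have := (key z).unique (key 0)
  rw [zero_add] at this
  linear_combination this

lemma analyticAt_wzeta (hτ : 0 < τ.im) {z : ℂ} (hz : z ∉ lattice τ) : AnalyticAt ℂ (wzeta τ) z := by
  rw [funext (wzeta_eq_add_zetaRegular hτ)]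
  refine .add (.div (by fun_prop) (by fun_prop) ?_) (analyticAt_zetaRegular hτ (.inr hz))
  rintro rfl
  exact hz zero_mem_lattice

/-- The quotient `σ_λ σ_μ / σ_{λ+μ}` minus `ζ(z) - ζ(z - λ - μ)`. -/
noncomputable def thetaZetaQuotient (τ lam μ z : ℂ) : ℂ :=
  theta1'0 τ * theta1 (-(lam + μ)) τ / (theta1 (-lam) τ * theta1 (-μ) τ) *
    (theta1 (z - lam) τ * theta1 (z - μ) τ / (theta1 z τ * theta1 (z - (lam + μ)) τ)) -
    wzeta τ z + wzeta τ (z - (lam + μ))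

lemma thetaZetaQuotient_add_one (hτ : 0 < τ.im) (lam μ z : ℂ) :
    thetaZetaQuotient τ lam μ (z + 1) = thetaZetaQuotient τ lam μ z := by
  have h1 : (1 : ℂ) ∈ lattice τ := ⟨1, 0, by simp⟩
  simp only [thetaZetaQuotient, add_sub_right_comm z 1, theta1_add_one, wzeta_add hτ h1,
    neg_mul_neg]
  ring

lemma thetaZetaQuotient_add_tau (hτ : 0 < τ.im) (lam μ z : ℂ) :
    thetaZetaQuotient τ lam μ (z + τ) = thetaZetaQuotient τ lam μ z := by
  have h1 : τ ∈ lattice τ := ⟨0, 1, by simp⟩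
  simp only [thetaZetaQuotient, add_sub_right_comm z τ, theta1_add_tau, wzeta_add hτ h1,
    neg_mul_neg]
  rw [mul_mul_mul_comm, mul_mul_mul_comm (cexp _) (theta1 z τ), ← Complex.exp_add,
    ← Complex.exp_add,
    show -(Real.pi * I * (τ + 2 * (z - lam))) + -(Real.pi * I * (τ + 2 * (z - μ))) =
      -(Real.pi * I * (τ + 2 * z)) + -(Real.pi * I * (τ + 2 * (z - (lam + μ)))) by ring,
    mul_div_mul_left _ _ (Complex.exp_ne_zero _)]
  ring

lemma thetaZetaQuotient_sub (hτ : 0 < τ.im) (lam μ z : ℂ) :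
    thetaZetaQuotient τ lam μ (lam + μ - z) = thetaZetaQuotient τ lam μ z := by
  simp only [thetaZetaQuotient]
  rw [show lam + μ - z - lam = -(z - μ) by ring, show lam + μ - z - μ = -(z - lam) by ring,
    show lam + μ - z - (lam + μ) = -z by ring, show lam + μ - z = -(z - (lam + μ)) by ring]
  simp only [theta1_neg _ τ, wzeta_neg hτ, neg_mul_neg]
  ring

lemma analyticAt_thetaZetaQuotient (hτ : 0 < τ.im) (h0 : theta1'0 τ ≠ 0) (lam μ : ℂ) {z : ℂ}
    (hz : z ∉ lattice τ) (hz' : z - (lam + μ) ∉ lattice τ) :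
    AnalyticAt ℂ (thetaZetaQuotient τ lam μ) z := by
  have hθ : ∀ a, AnalyticAt ℂ (fun w ↦ theta1 (w - a) τ) z := fun a ↦
    Differentiable.analyticAt ((differentiable_theta1 hτ).comp
      (differentiable_id.sub_const a)) z
  refine .add (.sub (.mul analyticAt_const (.div (.mul (hθ _) (hθ _)) (.mul ?_ (hθ _)) ?_))
    (analyticAt_wzeta hτ hz)) ?_
  · exact (differentiable_theta1 hτ).analyticAt z
  · exact mul_ne_zero (theta1_ne_zero hτ h0 hz) (theta1_ne_zero hτ h0 hz')
  · exact (analyticAt_wzeta hτ hz').fun_comp (f := fun w ↦ w - (lam + μ)) (by fun_prop)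

/-- The singularity of `thetaZetaQuotient` at `0` is removable. -/
lemma exists_thetaZetaQuotient_eventuallyEq (hτ : 0 < τ.im) (h0 : theta1'0 τ ≠ 0) {lam μ : ℂ}
    (hlam : lam ∉ lattice τ) (hμ : μ ∉ lattice τ) (hlamμ : lam + μ ∉ lattice τ) :
    ∃ g : ℂ → ℂ, AnalyticAt ℂ g 0 ∧ thetaZetaQuotient τ lam μ =ᶠ[𝓝[≠] 0] g := by
  have hθ0 : ∀ {w}, w ∉ lattice τ → theta1 w τ ≠ 0 := theta1_ne_zero hτ h0
  have hl := hθ0 (mt lattice_neg_mem_iff.mp hlam)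
  have hm := hθ0 (mt lattice_neg_mem_iff.mp hμ)
  have hs := mt lattice_neg_mem_iff.mp hlamμ
  have hlm := hθ0 hs
  have hθ : ∀ a, AnalyticAt ℂ (fun w ↦ theta1 (w - a) τ) 0 := fun a ↦
    Differentiable.analyticAt ((differentiable_theta1 hτ).comp
      (differentiable_id.sub_const a)) 0
  obtain ⟨t, ht, ht0, hθt⟩ := exists_analyticAt_eq_mul
    ((differentiable_theta1 hτ).analyticAt 0) (theta1_zero τ)
  change t 0 = theta1'0 τ at ht0
  have hM : AnalyticAt ℂ (fun w ↦ theta1'0 τ * theta1 (-(lam + μ)) τ /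
      (theta1 (-lam) τ * theta1 (-μ) τ) * (theta1 (w - lam) τ * theta1 (w - μ) τ /
        (t w * theta1 (w - (lam + μ)) τ)) - 1) 0 := by
    refine .sub (.mul analyticAt_const (.div (.mul (hθ _) (hθ _)) (.mul ht (hθ _)) ?_))
      analyticAt_const
    rw [zero_sub, ht0]
    exact mul_ne_zero h0 hlm
  obtain ⟨k, hk, -, hMk⟩ := exists_analyticAt_eq_mul hM (by
    rw [ht0]
    simp only [zero_sub]
    field_simp
    simp)
  refine ⟨fun w ↦ k w - zetaRegular hτ w + wzeta τ (w - (lam + μ)),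
    .add (.sub hk (analyticAt_zetaRegular hτ (.inl rfl))) ?_, ?_⟩
  · refine AnalyticAt.fun_comp (g := wzeta τ) (f := fun w ↦ w - (lam + μ)) ?_ (by fun_prop)
    rw [zero_sub]
    exact analyticAt_wzeta hτ hs
  · filter_upwards [self_mem_nhdsWithin] with w hw
    have hw : w ≠ 0 := hw
    have hkw : k w = (w * k w) / w := by field_simp
    rw [hkw, ← hMk, thetaZetaQuotient, hθt w, wzeta_eq_add_zetaRegular hτ w,
      mul_assoc w (t w), div_mul_eq_div_div_swap _ w]
    ring

lemma thetaZetaQuotient_eq (hτ : 0 < τ.im) (h0 : theta1'0 τ ≠ 0) {lam μ z : ℂ}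
    (hlam : lam ∉ lattice τ) (hμ : μ ∉ lattice τ) (hlamμ : lam + μ ∉ lattice τ)
    (hz : z ∉ lattice τ) (hz' : z - (lam + μ) ∉ lattice τ) :
    thetaZetaQuotient τ lam μ z = -wzeta τ lam - wzeta τ μ := by
  obtain ⟨g, hg, hEg⟩ := exists_thetaZetaQuotient_eventuallyEq hτ h0 hlam hμ hlamμ
  obtain ⟨c, hc⟩ := exists_eq_const_of_periodic hτ (thetaZetaQuotient_add_one hτ lam μ)
    (thetaZetaQuotient_add_tau hτ lam μ) (by
    intro z
    by_cases hz : z ∈ lattice τ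
    · exact ⟨-z, lattice_neg_mem hz, g, by simpa using hg, by simpa using hEg⟩
    by_cases hz' : z - (lam + μ) ∈ lattice τ
    · refine ⟨-(z - (lam + μ)), lattice_neg_mem hz', fun w ↦ g (lam + μ - w), ?_, ?_⟩ <;>
        rw [show z + -(z - (lam + μ)) = lam + μ by ring]
      · exact AnalyticAt.fun_comp (f := fun w ↦ lam + μ - w) (by simpa using hg) (by fun_prop)
      · have ht : Tendsto (fun w ↦ lam + μ - w) (𝓝[≠] (lam + μ)) (𝓝[≠] 0) :=
          tendsto_nhdsWithin_of_tendsto_nhds_of_eventually_within _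
            (tendsto_nhdsWithin_of_tendsto_nhds
              (Continuous.tendsto' (by fun_prop) _ _ (sub_self _)))
            (eventually_mem_nhdsWithin.mono fun w hw ↦ sub_ne_zero.mpr (Ne.symm hw))
        filter_upwards [ht.eventually hEg] with w hw
        rw [← hw, thetaZetaQuotient_sub hτ]
    · exact ⟨0, zero_mem_lattice, _, by
        simpa using analyticAt_thetaZetaQuotient hτ h0 lam μ hz hz', .rfl⟩)
  have e : lam - (lam + μ) = -μ := by ring
  rw [hc z (analyticAt_thetaZetaQuotient hτ h0 lam μ hz hz').continuousAt,
    ← hc lam (analyticAt_thetaZetaQuotient hτ h0 lam μ hlam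
      (by rwa [e, lattice_neg_mem_iff])).continuousAt, thetaZetaQuotient, e, sub_self, theta1_zero,
    wzeta_neg hτ]
  ring

end EllipticFunctions

/-- σ_λ(z)σ_μ(z) = σ_{λ+μ}(z)·(ζ(z) − ζ(λ) − ζ(μ) − ζ(z−λ−μ)). -/
theorem sigma_mul_sigma_zeta (τ : ℂ) (hτ : 0 < τ.im) (lam μ z : ℂ)
    (hlam : lam ∉ lattice τ) (hμ : μ ∉ lattice τ) (hlamμ : lam + μ ∉ lattice τ)
    (hz : z ∉ lattice τ) (hzlm : z - lam - μ ∉ lattice τ) :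
    sigmaE τ lam z * sigmaE τ μ z =
      sigmaE τ (lam + μ) z *
        (wzeta τ z - wzeta τ lam - wzeta τ μ - wzeta τ (z - lam - μ)) := by
  by_cases h0 : theta1'0 τ = 0
  · simp [sigmaE, h0]
  have hθ0 : ∀ {w}, w ∉ lattice τ → theta1 w τ ≠ 0 := theta1_ne_zero hτ h0
  rw [sub_sub] at hzlm
  have e := thetaZetaQuotient_eq hτ h0 hlam hμ hlamμ hz hzlm
  rw [thetaZetaQuotient] at e
  have hl := hθ0 (mt lattice_neg_mem_iff.mp hlam)
  have hm := hθ0 (mt lattice_neg_mem_iff.mp hμ)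
  have hlm := hθ0 (mt lattice_neg_mem_iff.mp hlamμ)
  have hz' := hθ0 hz
  have hzs := hθ0 hzlm
  rw [sub_sub z lam μ, show wzeta τ z - wzeta τ lam - wzeta τ μ - wzeta τ (z - (lam + μ)) =
    theta1'0 τ * theta1 (-(lam + μ)) τ / (theta1 (-lam) τ * theta1 (-μ) τ) *
      (theta1 (z - lam) τ * theta1 (z - μ) τ / (theta1 z τ * theta1 (z - (lam + μ)) τ)) by
    linear_combination -e]
  simp only [sigmaE]
  field_simp
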